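/- Let u ∈ C_c^∞(ℝ^{2n+1}) be a smooth compactly supported function on the Heisenberg group ℍ^n. Then 2n ∫_{ℝ^{2n+1}} |∇^H u|² dg = 2 ∫_{ℝ^{2n+1}} Zu · Δ_H u dg, where Zu = Σ_{i=1}^n x_i X_i u + Σ_{i=1}^n y_i X_{n+i} u + 2t Tu is the derivative along the generator of the non-isotropic dilations, 2n = Q − 2 with Q = 2n + 2 the homogeneous dimension, and dg denotes Lebesgue measure. -/

import Mathlib

open scoped BigOperators
noncomputable section

/-- The Heisenberg group ℍⁿ identified with ℝⁿ × ℝⁿ × ℝ, with coordinates (x, y, t). -/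
abbrev Heis (n : ℕ) : Type := (Fin n → ℝ) × (Fin n → ℝ) × ℝ

/-- The left-invariant horizontal vector fields `X_1, …, X_{2n}` acting on functions:
`X_j u = ∂u/∂x_j − (y_j/2) ∂u/∂t` for `j = 1,…,n` (indices `0,…,n-1` here) and
`X_{n+j} u = ∂u/∂y_j + (x_j/2) ∂u/∂t` (indices `n,…,2n-1`). -/
noncomputable def Xf (n : ℕ) (i : Fin (2 * n)) (u : Heis n → ℝ) (p : Heis n) : ℝ :=
  if h : (i : ℕ) < n then
    fderiv ℝ u p (Pi.single ⟨(i : ℕ), h⟩ 1, 0, 0)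
      - p.2.1 ⟨(i : ℕ), h⟩ / 2 * fderiv ℝ u p (0, 0, 1)
  else
    fderiv ℝ u p (0, Pi.single ⟨(i : ℕ) - n, by have := i.isLt; omega⟩ 1, 0)
      + p.1 ⟨(i : ℕ) - n, by have := i.isLt; omega⟩ / 2 * fderiv ℝ u p (0, 0, 1)

/-- The vertical vector field `T u = ∂u/∂t`. -/
noncomputable def Tf (n : ℕ) (u : Heis n → ℝ) (p : Heis n) : ℝ :=
  fderiv ℝ u p (0, 0, 1)

/-- The horizontal Laplacian `Δ_H u = Σ_{i=1}^{2n} X_i (X_i u)`. -/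
noncomputable def ΔH (n : ℕ) (u : Heis n → ℝ) (p : Heis n) : ℝ :=
  ∑ i : Fin (2 * n), Xf n i (Xf n i u) p

/-- The derivative along the generator of the non-isotropic dilations:
`Zu = Σ_i x_i X_i u + Σ_i y_i X_{n+i} u + 2t Tu`. -/
noncomputable def Zf (n : ℕ) (u : Heis n → ℝ) (p : Heis n) : ℝ :=
  (∑ i : Fin n, p.1 i * Xf n ⟨(i : ℕ), by have := i.isLt; omega⟩ u p)
    + (∑ i : Fin n, p.2.1 i * Xf n ⟨n + (i : ℕ), by have := i.isLt; omega⟩ u p)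
    + 2 * p.2.2 * Tf n u p

instance heisHaar (n : ℕ) :
    (MeasureTheory.volume : MeasureTheory.Measure (Heis n)).IsAddHaarMeasure := by
  have h1 : (MeasureTheory.volume : MeasureTheory.Measure ((Fin n → ℝ) × ℝ)).IsAddHaarMeasure :=
    MeasureTheory.Measure.prod.instIsAddHaarMeasure
      (MeasureTheory.volume : MeasureTheory.Measure (Fin n → ℝ)) MeasureTheory.volume
  exact MeasureTheory.Measure.prod.instIsAddHaarMeasure
    (MeasureTheory.volume : MeasureTheory.Measure (Fin n → ℝ))
    (MeasureTheory.volume : MeasureTheory.Measure ((Fin n → ℝ) × ℝ))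

open MeasureTheory in
lemma heis_ibp {n : ℕ} (φ : Heis n →L[ℝ] ℝ) (f : Heis n → ℝ) (hf : ContDiff ℝ 1 f)
    (hc : HasCompactSupport f) (v : Heis n) :
    ∫ p, φ p * fderiv ℝ f p v = - (φ v * ∫ p, f p) := by
  have hd : Continuous (fun p => fderiv ℝ f p v) :=
    (hf.continuous_fderiv one_ne_zero).clm_apply continuous_const
  have hcd : HasCompactSupport (fun p => fderiv ℝ f p v) := hc.fderiv_apply ℝ v
  rw [integral_mul_fderiv_eq_neg_fderiv_mul_of_integrable]
  · simp [integral_const_mul]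
  · simp only [ContinuousLinearMap.fderiv]
    exact (continuous_const.mul hf.continuous).integrable_of_hasCompactSupport hc.mul_left
  · exact (φ.continuous.mul hd).integrable_of_hasCompactSupport hcd.mul_left
  · exact (φ.continuous.mul hf.continuous).integrable_of_hasCompactSupport hc.mul_left
  · intro x _; exact φ.differentiableAt
  · intro x _; exact (hf.differentiable one_ne_zero) x

open MeasureTheory in
lemma heis_ibp0 {n : ℕ} (f : Heis n → ℝ) (hf : ContDiff ℝ 1 f)
    (hc : HasCompactSupport f) (v : Heis n) :
    ∫ p, fderiv ℝ f p v = 0 := by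
  have hd : Continuous (fun p => fderiv ℝ f p v) :=
    (hf.continuous_fderiv one_ne_zero).clm_apply continuous_const
  have hcd : HasCompactSupport (fun p => fderiv ℝ f p v) := hc.fderiv_apply ℝ v
  have := integral_mul_fderiv_eq_neg_fderiv_mul_of_integrable (μ := (volume : Measure (Heis n)))
    (f := fun _ => (1 : ℝ)) (g := f) (v := v) (by simp)
    (by simpa using hd.integrable_of_hasCompactSupport hcd)
    (by simpa using hf.continuous.integrable_of_hasCompactSupport hc)
    (by intro x _; fun_prop) (fun x _ => (hf.differentiable one_ne_zero) x)
  simpa using this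

/-- coordinate functionals -/
def cx {n : ℕ} (i : Fin n) : Heis n →L[ℝ] ℝ :=
  (ContinuousLinearMap.proj i).comp (ContinuousLinearMap.fst ℝ (Fin n → ℝ) ((Fin n → ℝ) × ℝ))

def cy {n : ℕ} (i : Fin n) : Heis n →L[ℝ] ℝ :=
  ((ContinuousLinearMap.proj i).comp (ContinuousLinearMap.fst ℝ (Fin n → ℝ) ℝ)).comp
    (ContinuousLinearMap.snd ℝ (Fin n → ℝ) ((Fin n → ℝ) × ℝ))

def ct {n : ℕ} : Heis n →L[ℝ] ℝ :=
  (ContinuousLinearMap.snd ℝ (Fin n → ℝ) ℝ).comp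
    (ContinuousLinearMap.snd ℝ (Fin n → ℝ) ((Fin n → ℝ) × ℝ))

@[simp] lemma cx_apply {n : ℕ} (i : Fin n) (p : Heis n) : cx i p = p.1 i := rfl
@[simp] lemma cy_apply {n : ℕ} (i : Fin n) (p : Heis n) : cy i p = p.2.1 i := rfl
@[simp] lemma ct_apply {n : ℕ} (p : Heis n) : ct p = p.2.2 := rfl

/-- the vertical direction -/
def et {n : ℕ} : Heis n := (0, 0, 1)

/-- dilation generator -/
def Dil (n : ℕ) : Heis n →L[ℝ] Heis n :=
  ContinuousLinearMap.id ℝ (Heis n) + (ct (n := n)).smulRight et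

lemma Dil_apply {n : ℕ} (p : Heis n) : Dil n p = p + p.2.2 • et := rfl

lemma Dil_eq {n : ℕ} (p : Heis n) : Dil n p =
    (∑ i, p.1 i • ((Pi.single i 1, 0, 0) : Heis n))
    + (∑ i, p.2.1 i • ((0, Pi.single i 1, 0) : Heis n)) + (2 * p.2.2) • et := by
  rw [Dil_apply]
  refine Prod.ext ?_ (Prod.ext ?_ ?_)
  · ext j; simp [et, Prod.fst_sum, Prod.snd_sum, Finset.sum_apply, Pi.single_apply]
  · ext j; simp [et, Prod.fst_sum, Prod.snd_sum, Finset.sum_apply, Pi.single_apply]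
  · simp [et, Prod.snd_sum]; ring

lemma Zf_eq {n : ℕ} (u : Heis n → ℝ) (p : Heis n) : Zf n u p = fderiv ℝ u p (Dil n p) := by
  rw [Dil_eq]
  simp only [map_add, map_sum, map_smul, smul_eq_mul, Zf, Xf, Tf, et]
  simp only [Fin.is_lt, dite_true, Fin.eta, add_lt_iff_neg_left, not_lt_zero, dite_false,
    add_tsub_cancel_left]
  have : ∑ i : Fin n, p.1 i * (p.2.1 i / 2 * fderiv ℝ u p (0, 0, 1))
    = ∑ i : Fin n, p.2.1 i * (p.1 i / 2 * fderiv ℝ u p (0, 0, 1)) :=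
    Finset.sum_congr rfl (fun i _ => by ring)
  simp only [mul_sub, mul_add, Finset.sum_sub_distrib, Finset.sum_add_distrib, this]
  ring

/-- A horizontal field: `Xf n i` is derivative along `a + φ p • et`. -/
lemma Xf_eq {n : ℕ} (i : Fin (2 * n)) : ∃ (a : Heis n) (φ : Heis n →L[ℝ] ℝ),
    a.2.2 = 0 ∧ φ et = 0 ∧ ∀ u, Xf n i u = fun p => fderiv ℝ u p (a + φ p • et) := by
  by_cases h : (i : ℕ) < n
  · refine ⟨(Pi.single ⟨i, h⟩ 1, 0, 0), (-(1/2 : ℝ)) • cy ⟨i, h⟩, rfl, by simp [et], ?_⟩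
    intro u; ext p
    simp only [Xf, h, dite_true, map_add, map_smul, smul_eq_mul, et,
      ContinuousLinearMap.smul_apply, cy_apply]
    ring
  · refine ⟨(0, Pi.single ⟨i - n, by omega⟩ 1, 0), ((1/2 : ℝ)) • cx ⟨i - n, by omega⟩, rfl,
      by simp [et], ?_⟩
    intro u; ext p
    simp only [Xf, h, dite_false, map_add, map_smul, smul_eq_mul, et,
      ContinuousLinearMap.smul_apply, cx_apply]
    ring

open MeasureTheory

lemma int_lin {n : ℕ} (φ : Heis n →L[ℝ] ℝ) (f : Heis n → ℝ) (hf : ContDiff ℝ 1 f)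
    (hc : HasCompactSupport f) (v : Heis n) :
    Integrable (fun p => φ p * fderiv ℝ f p v) :=
  (φ.continuous.mul ((hf.continuous_fderiv one_ne_zero).clm_apply
    continuous_const)).integrable_of_hasCompactSupport (hc.fderiv_apply ℝ v).mul_left

lemma int_X {n : ℕ} (a : Heis n) (φ : Heis n →L[ℝ] ℝ) (hφ : φ et = 0)
    (f : Heis n → ℝ) (hf : ContDiff ℝ 1 f) (hc : HasCompactSupport f) :
    ∫ p, fderiv ℝ f p (a + φ p • et) = 0 := by
  simp only [map_add, map_smul, smul_eq_mul]
  rw [integral_add _ (int_lin φ f hf hc et), heis_ibp0 f hf hc, heis_ibp φ f hf hc, hφ]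
  · simp
  · exact ((hf.continuous_fderiv one_ne_zero).clm_apply
      continuous_const).integrable_of_hasCompactSupport (hc.fderiv_apply ℝ a)

lemma int_D {n : ℕ} (f : Heis n → ℝ) (hf : ContDiff ℝ 1 f) (hc : HasCompactSupport f) :
    ∫ p, fderiv ℝ f p (Dil n p) = - ((2 * n + 2) * ∫ p, f p) := by
  have h1 : ∀ p, fderiv ℝ f p (Dil n p) =
      (∑ i, cx i p * fderiv ℝ f p (Pi.single i 1, 0, 0))
      + (∑ i, cy i p * fderiv ℝ f p (0, Pi.single i 1, 0))
      + 2 * (ct p * fderiv ℝ f p et) := by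
    intro p
    rw [Dil_eq]
    simp only [map_add, map_sum, map_smul, smul_eq_mul, cx_apply, cy_apply, ct_apply]
    ring
  simp only [h1]
  rw [integral_add, integral_add, integral_finsetSum, integral_finsetSum, integral_const_mul]
  · simp only [heis_ibp _ f hf hc]
    simp [et]
    ring
  · intro i _; exact int_lin _ f hf hc _
  · intro i _; exact int_lin _ f hf hc _
  · exact integrable_finsetSum _ fun i _ => int_lin _ f hf hc _
  · exact integrable_finsetSum _ fun i _ => int_lin _ f hf hc _
  · exact (integrable_finsetSum _ fun i _ => int_lin _ f hf hc _).add
      (integrable_finsetSum _ fun i _ => int_lin _ f hf hc _)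
  · exact (int_lin _ f hf hc _).const_mul _

lemma key {n : ℕ} (u : Heis n → ℝ) (hu : ContDiff ℝ (⊤ : ℕ∞) u) (hc : HasCompactSupport u)
    (i : Fin (2 * n)) :
    Integrable (fun p => (Xf n i u p) ^ 2) ∧ Integrable (fun p => Zf n u p * Xf n i (Xf n i u) p)
    ∧ ∫ p, Zf n u p * Xf n i (Xf n i u) p = n * ∫ p, (Xf n i u p) ^ 2 := by
  obtain ⟨a, φ, ha, hφ, hX⟩ := Xf_eq i
  have hZ : Zf n u = fun p => fderiv ℝ u p (Dil n p) := funext (Zf_eq u)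
  have hdu : ContDiff ℝ (⊤ : ℕ∞) (fderiv ℝ u) := hu.fderiv_right (by simp)
  set g := Xf n i u with hg
  set w := Zf n u with hw
  have hV : ContDiff ℝ (⊤ : ℕ∞) (fun p : Heis n => a + φ p • (et : Heis n)) := by fun_prop
  have hgC : ContDiff ℝ (⊤ : ℕ∞) g := by
    rw [hg, hX]; exact hdu.clm_apply hV
  have hwC : ContDiff ℝ (⊤ : ℕ∞) w := by
    rw [hZ]; exact hdu.clm_apply (Dil n).contDiff
  have hgc : HasCompactSupport g := by
    refine (hc.fderiv (𝕜 := ℝ)).mono' ?_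
    refine subset_trans (fun p hp => ?_) subset_closure
    rw [Function.mem_support] at hp ⊢
    intro h0; apply hp; rw [hg, hX]; simp [h0]
  have hg1 : ContDiff ℝ 1 g := hgC.of_le (by exact_mod_cast le_top)
  have hw1 : ContDiff ℝ 1 w := hwC.of_le (by exact_mod_cast le_top)
  have hgd : Differentiable ℝ g := hg1.differentiable one_ne_zero
  have hwd : Differentiable ℝ w := hw1.differentiable one_ne_zero
  have hdud : Differentiable ℝ (fderiv ℝ u) := hdu.differentiable (by simp)
  have hsymm : ∀ p v v', fderiv ℝ (fderiv ℝ u) p v v' = fderiv ℝ (fderiv ℝ u) p v' v := by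
    intro p v v'
    exact (hu.contDiffAt.isSymmSndFDerivAt (by simp; exact WithTop.coe_le_coe.2 (le_top : (2 : ℕ∞) ≤ ⊤))).eq v v'
  -- derivative formulas
  have hcomm : ∀ p, fderiv ℝ w p (a + φ p • et) = fderiv ℝ g p (Dil n p) + g p := by
    intro p
    have e1 : HasFDerivAt (fun q => Dil n q) (Dil n) p := (Dil n).hasFDerivAt
    have e2 : HasFDerivAt (fun q : Heis n => a + φ q • (et : Heis n)) (φ.smulRight et) p :=
      ((φ.smulRight (et : Heis n)).hasFDerivAt).const_add a
    have d := (hdud p).hasFDerivAt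
    have f1 := (d.clm_apply e1).fderiv
    have f2 := (d.clm_apply e2).fderiv
    rw [hZ, hg, hX, f1, f2]
    have hDφ : φ (Dil n p) = φ p := by rw [Dil_apply]; simp [hφ]
    have hDV : Dil n (a + φ p • et) = a + (2 * φ p) • et := by
      rw [Dil_apply]
      have : (a + φ p • (et : Heis n)).2.2 = φ p := by simp [ha, et]
      rw [this]; module
    simp only [ContinuousLinearMap.add_apply, ContinuousLinearMap.comp_apply,
      ContinuousLinearMap.flip_apply, ContinuousLinearMap.smulRight_apply, hDφ]
    rw [hDV, hsymm p (Dil n p)]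
    simp only [map_add, map_smul, smul_eq_mul]
    ring
  have hcg : Continuous g := hg1.continuous
  have hXg : Continuous (fun p => fderiv ℝ g p (a + φ p • et)) :=
    (hg1.continuous_fderiv one_ne_zero).clm_apply hV.continuous
  have hZg : Continuous (fun p => fderiv ℝ g p (Dil n p)) :=
    (hg1.continuous_fderiv one_ne_zero).clm_apply (Dil n).continuous
  have hXgc : HasCompactSupport (fun p => fderiv ℝ g p (a + φ p • et)) := by
    refine (hgc.fderiv (𝕜 := ℝ)).mono' ?_
    refine subset_trans (fun p hp => ?_) subset_closure
    rw [Function.mem_support] at hp ⊢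
    intro h0; apply hp; simp [h0]
  have I1 : Integrable (fun p => g p ^ 2) := by
    simp only [pow_two]
    exact (hcg.mul hcg).integrable_of_hasCompactSupport hgc.mul_left
  have I2 : Integrable (fun p => w p * fderiv ℝ g p (a + φ p • et)) :=
    (hw1.continuous.mul hXg).integrable_of_hasCompactSupport hXgc.mul_left
  have I3 : Integrable (fun p => g p * fderiv ℝ g p (Dil n p)) :=
    (hcg.mul hZg).integrable_of_hasCompactSupport hgc.mul_right
  rw [hX g]
  refine ⟨I1, I2, ?_⟩
  have A := int_X a φ hφ (fun p => w p * g p) (hw1.mul hg1) hgc.mul_left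
  have B := int_D (fun p => g p * g p) (hg1.mul hg1) hgc.mul_left
  have A' : ∀ p, fderiv ℝ (fun p => w p * g p) p (a + φ p • et)
      = w p * fderiv ℝ g p (a + φ p • et) + (g p * fderiv ℝ g p (Dil n p) + g p ^ 2) := by
    intro p
    rw [fderiv_fun_mul (hwd p) (hgd p), ContinuousLinearMap.add_apply,
      ContinuousLinearMap.smul_apply, ContinuousLinearMap.smul_apply, hcomm]
    simp only [smul_eq_mul]; ring
  have B' : ∀ p, fderiv ℝ (fun p => g p * g p) p (Dil n p)
      = 2 * (g p * fderiv ℝ g p (Dil n p)) := by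
    intro p
    rw [fderiv_fun_mul (hgd p) (hgd p), ContinuousLinearMap.add_apply,
      ContinuousLinearMap.smul_apply]
    simp only [smul_eq_mul]; ring
  simp only [A'] at A
  simp only [B'] at B
  simp only [← pow_two] at B
  have I4 : Integrable (fun p => g p * fderiv ℝ g p (Dil n p) + g p ^ 2) := I3.add I1
  rw [integral_add I2 I4, integral_add I3 I1] at A
  rw [integral_const_mul] at B
  linarith

/-- For u ∈ C_c^∞(ℍⁿ): (Q−2) ∫ |∇^H u|² = 2 ∫ Zu · Δ_H u, with Q − 2 = 2n. -/
theorem heisenberg_rellich_dilation (n : ℕ) (u : Heis n → ℝ)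
    (hu : ContDiff ℝ (⊤ : ℕ∞) u) (hc : HasCompactSupport u) :
    (2 * n : ℝ) * ∫ p : Heis n, ∑ i : Fin (2 * n), (Xf n i u p) ^ 2
      = 2 * ∫ p : Heis n, Zf n u p * ΔH n u p := by
  simp only [ΔH, Finset.mul_sum]
  rw [integral_finsetSum _ (fun i _ => (key u hu hc i).1),
    integral_finsetSum _ (fun i _ => (key u hu hc i).2.1),
    Finset.sum_congr rfl (fun i _ => (key u hu hc i).2.2), ← Finset.mul_sum]
  ring
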